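/- Let O_F be a Dedekind domain with fraction field F, K a quadratic étale F-algebra, V a free K-module of rank one, and Λ ⊆ V a full O_F-lattice. Let O(Λ) = {λ ∈ K : λΛ ⊆ Λ}, which is an O_F-order in K. Then Λ is a projective O(Λ)-module of rank one. -/

import Mathlib

open Module Submodule

section

variable (O_F F K V : Type*) [CommRing O_F] [Field F] [CommRing K]
  [Algebra O_F F] [Algebra F K] [Algebra O_F K] [IsScalarTower O_F F K]
  [AddCommGroup V] [Module K V] [Module F V] [IsScalarTower F K V]
  [Module O_F V] [IsScalarTower O_F K V] [IsScalarTower O_F F V]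

/-- A full `O_F`-lattice in `V`: a finitely generated `O_F`-submodule
spanning `V` over `F`. -/
def IsFullLattice (Λ : Submodule O_F V) : Prop :=
  Λ.FG ∧ Submodule.span F (Λ : Set V) = ⊤

variable {O_F F K V}

/-- The multiplier order `O(Λ) = {a ∈ K : aΛ ⊆ Λ}` of a lattice `Λ`,
as an `O_F`-subalgebra of `K`. -/
def multiplierOrder (K : Type*) {O_F V : Type*} [CommRing O_F] [CommRing K]
    [Algebra O_F K] [AddCommGroup V] [Module K V] [Module O_F V]
    [IsScalarTower O_F K V] (Λ : Submodule O_F V) : Subalgebra O_F K where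
  carrier := {a : K | ∀ x ∈ Λ, a • x ∈ Λ}
  add_mem' := fun {a b} ha hb x hx => by
    rw [add_smul]; exact Λ.add_mem (ha x hx) (hb x hx)
  mul_mem' := fun {a b} ha hb x hx => by
    rw [mul_smul]; exact ha _ (hb x hx)
  one_mem' := fun x hx => by simpa using hx

  zero_mem' := fun x hx => by simpa using Λ.zero_mem
  algebraMap_mem' := fun r x hx => by
    rw [algebraMap_smul]; exact Λ.smul_mem r hx

/-- `Λ` is a module over its multiplier order. -/
instance multiplierOrder.moduleLattice {O_F K V : Type*} [CommRing O_F] [CommRing K]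
    [Algebra O_F K] [AddCommGroup V] [Module K V] [Module O_F V]
    [IsScalarTower O_F K V] (Λ : Submodule O_F V) :
    Module (multiplierOrder K Λ) Λ where
  smul a x := ⟨(a : K) • (x : V), a.2 x.1 x.2⟩
  one_smul x := Subtype.ext (one_smul K (x : V))
  mul_smul a b x := Subtype.ext (mul_smul (a : K) (b : K) (x : V))
  smul_zero a := Subtype.ext (smul_zero (a : K))
  smul_add a x y := Subtype.ext (smul_add (a : K) (x : V) (y : V))
  add_smul a b x := Subtype.ext (add_smul (a : K) (b : K) (x : V))
  zero_smul x := Subtype.ext (zero_smul K (x : V))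

end

/-- Every vector has a denominator in a submodule spanning over the fraction field. -/
lemma exists_ne_zero_smul_mem_of_span_eq_top {R F M : Type*} [CommRing R] [IsDomain R] [Field F]
    [Algebra R F] [IsFractionRing R F] [AddCommGroup M] [Module R M] [Module F M]
    [IsScalarTower R F M] {N : Submodule R M} (hN : Submodule.span F (N : Set M) = ⊤) (v : M) :
    ∃ d : R, d ≠ 0 ∧ d • v ∈ N := by
  have hv : v ∈ Submodule.span F (N : Set M) := hN ▸ Submodule.mem_top
  induction hv using Submodule.span_induction with
  | mem x hx => exact ⟨1, one_ne_zero, by rwa [one_smul]⟩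
  | zero => exact ⟨1, one_ne_zero, by simp⟩
  | add x y _ _ hx hy =>
    obtain ⟨c, hc, hcx⟩ := hx
    obtain ⟨d, hd, hdy⟩ := hy
    refine ⟨c * d, mul_ne_zero hc hd, ?_⟩
    rw [smul_add, mul_comm, mul_smul, mul_comm, mul_smul]
    exact N.add_mem (N.smul_mem d hcx) (N.smul_mem c hdy)
  | smul a x _ hx =>
    obtain ⟨c, hc, hcx⟩ := hx
    obtain ⟨r, s, hs, rfl⟩ := IsFractionRing.div_surjective (A := R) a
    have hs0 : algebraMap R F s ≠ 0 :=
      IsFractionRing.to_map_ne_zero_of_mem_nonZeroDivisors hs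
    refine ⟨c * s, mul_ne_zero hc (nonZeroDivisors.ne_zero hs), ?_⟩
    have : (c * s) • (algebraMap R F r / algebraMap R F s) • x = r • c • x := by
      simp only [← algebraMap_smul F (_ : R) (_ : M), map_mul, smul_smul]
      congr 1
      field_simp
    rw [this]
    exact N.smul_mem r hcx

/-- A finitely generated submodule has a common denominator. -/
lemma exists_ne_zero_forall_smul_mem_of_fg {R M : Type*} [CommRing R] [IsDomain R]
    [AddCommGroup M] [Module R M] {N P : Submodule R M} (hP : P.FG)
    (hN : ∀ v : M, ∃ d : R, d ≠ 0 ∧ d • v ∈ N) :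
    ∃ d : R, d ≠ 0 ∧ ∀ x ∈ P, d • x ∈ N := by
  induction P, hP using Submodule.fg_induction with
  | singleton x =>
    obtain ⟨d, hd, hdx⟩ := hN x
    refine ⟨d, hd, fun y hy => ?_⟩
    obtain ⟨r, rfl⟩ := Submodule.mem_span_singleton.mp hy
    rw [smul_comm]
    exact N.smul_mem r hdx
  | sup P₁ P₂ _ _ h₁ h₂ =>
    obtain ⟨c, hc, hcP⟩ := h₁
    obtain ⟨d, hd, hdP⟩ := h₂
    refine ⟨c * d, mul_ne_zero hc hd, fun x hx => ?_⟩
    obtain ⟨y, hy, z, hz, rfl⟩ := Submodule.mem_sup.mp hx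
    rw [smul_add, mul_comm, mul_smul, mul_comm, mul_smul]
    exact N.add_mem (N.smul_mem d (hcP y hy)) (N.smul_mem c (hdP z hz))

/-- Finitely generated nonzero submodules of the fraction field of a Dedekind domain are
invertible. -/
lemma one_mem_mul_one_div_of_fg {R F : Type*} [CommRing R] [IsDedekindDomain R]
    [Field F] [Algebra R F] [IsFractionRing R F] {N : Submodule R F} (hN : N.FG) (h0 : N ≠ ⊥) :
    (1 : F) ∈ N * (1 / N) := by
  let I : FractionalIdeal (nonZeroDivisors R) F := ⟨N, FractionalIdeal.isFractional_of_fg hN⟩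
  have hI : I ≠ 0 := fun h => h0 (by
    have := congrArg (fun J : FractionalIdeal (nonZeroDivisors R) F => (J : Submodule R F)) h
    simpa [I] using this)
  have hmul := mul_inv_cancel₀ hI
  have := congrArg (fun J : FractionalIdeal (nonZeroDivisors R) F => (J : Submodule R F)) hmul
  simp only [FractionalIdeal.coe_mul, FractionalIdeal.inv_eq, FractionalIdeal.coe_div hI,
    FractionalIdeal.coe_one] at this
  change N * (1 / N) = 1 at this
  rw [this]
  exact Submodule.one_le.mp le_rfl

/-- Every element `x` of a quadratic algebra satisfies `x * (tr x - x) ∈ F`. -/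
lemma mul_trace_sub_self_mem_range {F K : Type*} [Field F] [CommRing K] [Algebra F K]
    (hquad : Module.finrank F K = 2) (x : K) :
    x * (algebraMap F K (Algebra.trace F K x) - x) ∈ Set.range (algebraMap F K) := by
  have : Module.Finite F K := Module.finite_of_finrank_pos (by omega)
  let b : Basis (Fin 2) F K := Module.finBasisOfFinrankEq F K hquad
  have h := Matrix.aeval_self_charpoly (Algebra.leftMulMatrix b x)
  rw [Matrix.charpoly_fin_two, Polynomial.aeval_algHom_apply,
    map_eq_zero_iff _ (Algebra.leftMulMatrix_injective b),
    ← Algebra.trace_eq_matrix_trace] at h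
  simp only [map_add, map_sub, map_mul, map_pow, Polynomial.aeval_X, Polynomial.aeval_C] at h
  exact ⟨(Algebra.leftMulMatrix b x).det, by linear_combination h⟩

/-- Membership in an `R`-submodule can be tested after scaling by the elements `m * c i`, where
`m` ranges over the inverse of the fractional ideal generated by a nonzero family `c`. -/
lemma mem_of_forall_inv_mul_smul_mem {R F K ι : Type*} [CommRing R]
    [IsDedekindDomain R] [Field F] [Algebra R F] [IsFractionRing R F] [AddCommGroup K]
    [Module F K] [Module R K] [IsScalarTower R F K] [Fintype ι] {c : ι → F} (hc : c ≠ 0)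
    (P : Submodule R K) (t : K)
    (h : ∀ (i : ι) (m : F), (∀ j, ∃ r : R, algebraMap R F r = m * c j) → (m * c i) • t ∈ P) :
    t ∈ P := by
  have h1 : (1 : F) ∈ Submodule.span R (Set.range c) * (1 / Submodule.span R (Set.range c)) := by
    refine one_mem_mul_one_div_of_fg (Submodule.fg_span (Set.finite_range c)) fun h0 => hc ?_
    funext i
    exact Submodule.span_eq_bot.mp h0 _ ⟨i, rfl⟩
  suffices ∀ r ∈ Submodule.span R (Set.range c) * (1 / Submodule.span R (Set.range c)),
      r • t ∈ P by simpa using this 1 h1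
  intro r hr
  induction hr using Submodule.mul_induction_on' with
  | mem_mul_mem a ha m hm =>
    rw [Submodule.mem_div_iff_forall_mul_mem] at hm
    induction ha using Submodule.span_induction with
    | mem x hx =>
      obtain ⟨i, rfl⟩ := hx
      rw [mul_comm]
      exact h i m fun j => Submodule.mem_one.mp (hm _ (Submodule.subset_span ⟨j, rfl⟩))
    | zero => simp
    | add x y _ _ hx hy => rw [add_mul, add_smul]; exact P.add_mem hx hy
    | smul s x _ hx => rw [smul_mul_assoc, smul_assoc]; exact P.smul_mem s hx
  | add x _ y _ hx hy => rw [add_smul]; exact P.add_mem hx hy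

/-- In a quadratic algebra with conjugation `σ`, the products `σ x * y * z` of elements of a
lattice `L` lie in `N L`, where the fractional ideal `N` contains the norms `x * σ x` of `L`. -/
lemma smul_conj_mul_mul_mem {R F K : Type*} [CommRing R]
    [IsDedekindDomain R] [Field F] [Algebra R F] [IsFractionRing R F] [CommRing K] [Algebra F K]
    [Algebra R K] [IsScalarTower R F K] (hquad : Module.finrank F K = 2)
    (σ : K →ₗ[F] K) {L : Submodule R K} {N : Submodule R F}
    (hN : ∀ x ∈ L, ∃ q ∈ N, algebraMap F K q = x * σ x) {n : F} (hn : n ∈ 1 / N)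
    {x y z : K} (hx : x ∈ L) (hy : y ∈ L) (hz : z ∈ L) :
    n • (σ x * y * z) ∈ L := by
  have hσR (r : R) (x : K) : σ (r • x) = r • σ x := by
    rw [← algebraMap_smul F r x, map_smul, algebraMap_smul]
  have hnorm : ∀ x ∈ L, ∀ z ∈ L, n • (σ x * x * z) ∈ L := by
    intro x hx z hz
    obtain ⟨q, hq, hqx⟩ := hN x hx
    obtain ⟨r, hr⟩ := Submodule.mem_one.mp (Submodule.mem_div_iff_forall_mul_mem.mp hn q hq)
    rw [mul_comm (σ x), ← hqx, ← Algebra.smul_def, smul_smul, ← hr, algebraMap_smul]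
    exact L.smul_mem r hz
  have hpolar : ∀ x ∈ L, ∀ y ∈ L, n • (σ x * y * y) ∈ L := by
    intro x hx y hy
    have h1 := hnorm _ (L.add_mem hx hy) y hy
    have h2 := hnorm x hx y hy
    have h3 := hnorm y hy y hy
    have h4 := hnorm y hy x hx
    have : n • (σ x * y * y) = n • (σ (x + y) * (x + y) * y) - n • (σ x * x * y)
        - n • (σ y * y * y) - n • (σ y * y * x) := by
      rw [← smul_sub, ← smul_sub, ← smul_sub, map_add]
      congr 1
      ring
    rw [this]
    exact L.sub_mem (L.sub_mem (L.sub_mem h1 h2) h3) h4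
  have hdep : ¬ LinearIndependent F ![x, y, z] := fun h => by
    have : Module.Finite F K := Module.finite_of_finrank_pos (by omega)
    have := h.fintype_card_le_finrank
    simp [hquad] at this
  obtain ⟨c, hc, i₀, hi₀⟩ := Fintype.not_linearIndependent_iff.mp hdep
  simp only [Fin.sum_univ_three, Matrix.cons_val] at hc
  refine mem_of_forall_inv_mul_smul_mem (c := c) (fun h => hi₀ (congrFun h i₀)) L _ ?_
  intro i m hm
  choose r hr using hm
  have hrel : r 0 • x + r 1 • y + r 2 • z = 0 := by
    simp only [← algebraMap_smul F (_ : R) (_ : K), hr, mul_smul, ← smul_add, hc, smul_zero]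
  rw [← hr, algebraMap_smul]
  fin_cases i
  · have : r 0 • n • (σ x * y * z) = -(r 1 • n • (σ y * y * z)) - r 2 • n • (σ z * z * y) := by
      have h0 : r 0 • σ x = -(r 1 • σ y) - r 2 • σ z := by
        rw [← hσR, ← hσR, ← hσR, ← map_neg, ← map_sub]
        congr 1
        linear_combination hrel
      simp only [smul_comm _ n, ← smul_neg, ← smul_sub]
      congr 1
      simp only [Algebra.smul_def] at h0 ⊢
      linear_combination (y * z) * h0
    exact this ▸ L.sub_mem (L.neg_mem (L.smul_mem _ (hnorm y hy z hz)))
      (L.smul_mem _ (hnorm z hz y hy))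
  · have : r 1 • n • (σ x * y * z) = -(r 0 • n • (σ x * x * z)) - r 2 • n • (σ x * z * z) := by
      simp only [smul_comm _ n, ← smul_neg, ← smul_sub]
      congr 1
      simp only [Algebra.smul_def] at hrel ⊢
      linear_combination (σ x * z) * hrel
    exact this ▸ L.sub_mem (L.neg_mem (L.smul_mem _ (hnorm x hx z hz)))
      (L.smul_mem _ (hpolar x hx z hz))
  · have : r 2 • n • (σ x * y * z) = -(r 0 • n • (σ x * x * y)) - r 1 • n • (σ x * y * y) := by
      simp only [smul_comm _ n, ← smul_neg, ← smul_sub]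
      congr 1
      simp only [Algebra.smul_def] at hrel ⊢
      linear_combination (σ x * y) * hrel
    exact this ▸ L.sub_mem (L.neg_mem (L.smul_mem _ (hnorm x hx y hy)))
      (L.smul_mem _ (hpolar x hx y hy))

/-- A lattice in a quadratic algebra is invertible over its multiplier ring. -/
lemma one_mem_span_mul_of_quadratic {R F K : Type*} [CommRing R]
    [IsDedekindDomain R] [Field F] [Algebra R F] [IsFractionRing R F] [CommRing K] [Algebra F K]
    [Algebra R K] [IsScalarTower R F K] (hquad : Module.finrank F K = 2)
    {L : Submodule R K} (hfg : L.FG) (hL : ∀ v : K, ∃ d : R, d ≠ 0 ∧ d • v ∈ L) :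
    (1 : K) ∈ Submodule.span R {k : K | ∃ m, (∀ y ∈ L, ∀ z ∈ L, m * y * z ∈ L) ∧
      ∃ x ∈ L, m * x = k} := by
  have : Nontrivial K := Module.nontrivial_of_finrank_pos (R := F) (by omega)
  let σ : K →ₗ[F] K := Algebra.linearMap F K ∘ₗ Algebra.trace F K - LinearMap.id
  let S : Submodule R K := L * L.map (σ.restrictScalars R)
  let N : Submodule R F := S.comap ((Algebra.linearMap F K).restrictScalars R)
  have hNfg : N.FG := by
    refine Submodule.fg_of_fg_map_injective ((Algebra.linearMap F K).restrictScalars R)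
      (algebraMap F K).injective ?_
    exact (hfg.mul (hfg.map _)).of_le (Submodule.map_comap_le _ _)
  have hN : ∀ x ∈ L, ∃ q ∈ N, algebraMap F K q = x * σ x := by
    intro x hx
    obtain ⟨q, hq⟩ := mul_trace_sub_self_mem_range hquad x
    refine ⟨q, ?_, hq⟩
    change algebraMap F K q ∈ S
    rw [hq]
    exact Submodule.mul_mem_mul hx ⟨x, hx, rfl⟩
  have hN0 : N ≠ ⊥ := by
    obtain ⟨d, hd, hd1⟩ := hL 1
    obtain ⟨q, hq, hq1⟩ := hN _ hd1
    have hσ1 : σ 1 = 1 := by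
      have : Algebra.trace F K 1 = 2 := by
        simpa [hquad] using Algebra.trace_algebraMap (R := F) (S := K) 1
      simp only [σ, LinearMap.sub_apply, LinearMap.comp_apply, this, Algebra.linearMap_apply,
        LinearMap.id_apply, map_ofNat]
      norm_num
    rw [← algebraMap_smul F d, map_smul, hσ1, smul_mul_smul_comm, one_mul,
      ← Algebra.algebraMap_eq_smul_one, (algebraMap F K).injective.eq_iff] at hq1
    refine fun h => mul_ne_zero hd hd (IsFractionRing.injective R F ?_)
    rw [map_mul, map_zero, ← hq1]
    simpa [h] using hq
  have h1 := one_mem_mul_one_div_of_fg hNfg hN0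
  suffices ∀ r ∈ N * (1 / N), algebraMap F K r ∈ Submodule.span R {k : K | ∃ m,
      (∀ y ∈ L, ∀ z ∈ L, m * y * z ∈ L) ∧ ∃ x ∈ L, m * x = k} by simpa using this 1 h1
  intro r hr
  induction hr using Submodule.mul_induction_on' with
  | mem_mul_mem q hq n hn =>
    have hqS : algebraMap F K q ∈ S := hq
    rw [mul_comm, map_mul, ← Algebra.smul_def]
    generalize algebraMap F K q = p at hqS
    induction hqS using Submodule.mul_induction_on' with
    | mem_mul_mem x hx w hw =>
      obtain ⟨y, hy, rfl⟩ := hw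
      refine Submodule.subset_span ⟨n • σ y, fun u hu v hv => ?_, x, hx, ?_⟩
      · rw [smul_mul_assoc, smul_mul_assoc]
        exact smul_conj_mul_mul_mem hquad σ hN hn hy hu hv
      · rw [smul_mul_assoc, mul_comm]
        rfl
    | add x _ y _ hx hy => rw [smul_add]; exact Submodule.add_mem _ hx hy
  | add x _ y _ hx hy => rw [map_add]; exact Submodule.add_mem _ hx hy

lemma multiplierOrder.coe_smul {R K V : Type*} [CommRing R] [CommRing K]
    [Algebra R K] [AddCommGroup V] [Module K V] [Module R V]
    [IsScalarTower R K V] {Λ : Submodule R V} (a : multiplierOrder K Λ) (x : Λ) :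
    ((a • x : Λ) : V) = (a : K) • (x : V) := rfl

lemma multiplierOrder.mem_iff {R K V : Type*} [CommRing R] [CommRing K]
    [Algebra R K] [AddCommGroup V] [Module K V] [Module R V]
    [IsScalarTower R K V] {Λ : Submodule R V} {a : K} :
    a ∈ multiplierOrder K Λ ↔ ∀ x ∈ Λ, a • x ∈ Λ := Iff.rfl

/-- A lattice is projective over its multiplier ring as soon as it is invertible. -/
lemma multiplierOrder.projective_of_one_mem_span {R K V : Type*} [CommRing R] [CommRing K]
    [Algebra R K] [AddCommGroup V] [Module K V] [Module R V]
    [IsScalarTower R K V] (e : V ≃ₗ[K] K) {Λ : Submodule R V}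
    (h : (1 : K) ∈ Submodule.span R {k : K | ∃ m, (∀ y ∈ Λ, m * e y ∈ multiplierOrder K Λ) ∧
      ∃ x ∈ Λ, m * e x = k}) :
    Module.Projective (multiplierOrder K Λ) Λ := by
  suffices ∀ k ∈ Submodule.span R {k : K | ∃ m, (∀ y ∈ Λ, m * e y ∈ multiplierOrder K Λ) ∧
      ∃ x ∈ Λ, m * e x = k}, ∃ s : Λ →ₗ[multiplierOrder K Λ] (Λ →₀ multiplierOrder K Λ),
        ∀ x : Λ, ((Finsupp.linearCombination (multiplierOrder K Λ) id (s x) : Λ) : V) = k • (x : V) by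
    obtain ⟨s, hs⟩ := this 1 h
    exact Module.projective_def'.mpr ⟨s, LinearMap.ext fun x => Subtype.ext (by simpa using hs x)⟩
  intro k hk
  induction hk using Submodule.span_induction with
  | mem k hk =>
    obtain ⟨m, hm, x, hx, rfl⟩ := hk
    let φ : Λ →ₗ[multiplierOrder K Λ] multiplierOrder K Λ :=
      { toFun := fun y => ⟨m * e y, hm y y.2⟩
        map_add' := fun y z => Subtype.ext (by simp [mul_add])
        map_smul' := fun a y => Subtype.ext (by
          simp [multiplierOrder.coe_smul, mul_left_comm]) }
    refine ⟨Finsupp.lsingle ⟨x, hx⟩ ∘ₗ φ, fun y => e.injective ?_⟩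
    simp [φ, multiplierOrder.coe_smul]
    ring
  | zero => exact ⟨0, fun x => by simp⟩
  | add k l _ _ hk hl =>
    obtain ⟨s, hs⟩ := hk
    obtain ⟨t, ht⟩ := hl
    exact ⟨s + t, fun x => by simp [hs, ht, add_smul]⟩
  | smul r k _ hk =>
    obtain ⟨s, hs⟩ := hk
    refine ⟨algebraMap R (multiplierOrder K Λ) r • s, fun x => ?_⟩
    rw [LinearMap.smul_apply, map_smul, multiplierOrder.coe_smul, hs, smul_assoc,
      ← algebraMap_smul K r (k • (x : V))]
    rfl

/-- Every element of the algebra has a denominator in the multiplier ring of a lattice. -/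
lemma multiplierOrder.exists_ne_zero_smul_mem {R K V : Type*} [CommRing R] [IsDomain R]
    [CommRing K] [Algebra R K] [AddCommGroup V] [Module K V] [Module R V] [IsScalarTower R K V]
    {Λ : Submodule R V} (hfg : Λ.FG) (hΛ : ∀ v : V, ∃ d : R, d ≠ 0 ∧ d • v ∈ Λ) (a : K) :
    ∃ d : R, d ≠ 0 ∧ d • a ∈ multiplierOrder K Λ := by
  obtain ⟨d, hd, h⟩ := exists_ne_zero_forall_smul_mem_of_fg
    (hfg.map ((LinearMap.lsmul K V a).restrictScalars R)) hΛ
  refine ⟨d, hd, fun x hx => ?_⟩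
  rw [smul_assoc]
  exact h _ ⟨x, hx, rfl⟩

/-- The multiplier ring of a lattice containing a torsion-free vector is finitely generated. -/
lemma multiplierOrder.fg {R K V : Type*} [CommRing R] [IsNoetherianRing R]
    [CommRing K] [Algebra R K] [AddCommGroup V] [Module K V] [Module R V] [IsScalarTower R K V]
    {Λ : Submodule R V} (hfg : Λ.FG) {v : V} (hv : v ∈ Λ) (hv0 : ∀ a : K, a • v = 0 → a = 0) :
    (Subalgebra.toSubmodule (multiplierOrder K Λ)).FG := by
  refine Submodule.fg_of_fg_map_injective ((LinearMap.toSpanSingleton K V v).restrictScalars R)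
    ((injective_iff_map_eq_zero _).mpr hv0) (hfg.of_le ?_)
  rintro _ ⟨a, ha, rfl⟩
  exact ha v hv

/-- A lattice in a free module of rank one has rank one over its multiplier ring. -/
lemma multiplierOrder.rank_eq_one {R K V : Type*} [CommRing R] [CommRing K] [Nontrivial K]
    [Algebra R K] [AddCommGroup V] [Module K V] [Module R V] [IsScalarTower R K V]
    (e : V ≃ₗ[K] K) {Λ : Submodule R V}
    (hR : ∀ d : R, d ≠ 0 → ∀ a : K, d • a = 0 → a = 0)
    (hden : ∀ a : K, ∃ d : R, d ≠ 0 ∧ d • a ∈ multiplierOrder K Λ)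
    {v : V} (hv : v ∈ Λ) (hv0 : ∀ a : K, a • v = 0 → a = 0) :
    Module.rank (multiplierOrder K Λ) Λ = 1 := by
  refine le_antisymm ?_ ?_
  · rw [← Nat.cast_one]
    refine rank_le fun s hs => Finset.card_le_one.mpr fun x hx y hy => ?_
    by_contra hxy
    have hpair : LinearIndependent (multiplierOrder K Λ) ![x, y] := by
      have := hs.comp ![⟨x, hx⟩, ⟨y, hy⟩] (by
        intro i j hij
        fin_cases i <;> fin_cases j <;> simp_all [eq_comm])
      convert this using 1
      ext i
      fin_cases i <;> rfl
    obtain ⟨c, hc, hcx⟩ := hden (e x)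
    obtain ⟨d, hd, hdy⟩ := hden (e y)
    rw [LinearIndependent.pair_iff] at hpair
    have hxy0 := hpair (c • ⟨d • e y, hdy⟩) (-(d • ⟨c • e x, hcx⟩)) (Subtype.ext (e.injective (by
      simp [multiplierOrder.coe_smul, Algebra.smul_def]
      ring)))
    have hy0 : e y = 0 := hR d hd _ (hR c hc _ (congrArg Subtype.val hxy0.1))
    have := hpair 0 1 (by simpa using hy0)
    exact one_ne_zero this.2
  · have : LinearIndependent (multiplierOrder K Λ) (fun _ : Unit => (⟨v, hv⟩ : Λ)) := by
      refine Fintype.linearIndependent_iff.mpr fun g hg i => Subtype.ext (hv0 _ ?_)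
      simpa [multiplierOrder.coe_smul] using congrArg Subtype.val hg
    simpa using this.cardinal_lift_le_rank

/-- for a Dedekind domain `O_F` with fraction field `F`, a quadratic étale
`F`-algebra `K`, a free rank-one `K`-module `V`, and a full `O_F`-lattice `Λ ⊆ V`, the
multiplier ring `O(Λ)` is an `O_F`-order in `K`, and `Λ` is a projective `O(Λ)`-module
of rank one. -/
theorem lattice_projective_rank_one
    (O_F F K V : Type*) [CommRing O_F] [IsDomain O_F] [IsDedekindDomain O_F]
    [Field F] [Algebra O_F F] [IsFractionRing O_F F]
    [CommRing K] [IsSemisimpleRing K] [Algebra F K] [Algebra O_F K]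
    [IsScalarTower O_F F K] (hquad : Module.finrank F K = 2)
    [AddCommGroup V] [Module K V] [Module F V] [IsScalarTower F K V]
    [Module O_F V] [IsScalarTower O_F K V] [IsScalarTower O_F F V]
    (b : Basis (Fin 1) K V)
    (Λ : Submodule O_F V) (hΛ : IsFullLattice O_F F V Λ) :
    (Subalgebra.toSubmodule (multiplierOrder K Λ)).FG ∧
    Submodule.span F ((multiplierOrder K Λ : Set K)) = ⊤ ∧
    Module.Projective (multiplierOrder K Λ) Λ ∧
    Module.rank (multiplierOrder K Λ) Λ = 1 := by
  have : Nontrivial K := Module.nontrivial_of_finrank_pos (R := F) (by omega)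
  let e : V ≃ₗ[K] K := b.equivFun.trans (LinearEquiv.funUnique (Fin 1) K K)
  obtain ⟨hfg, hspan⟩ := hΛ
  have hden : ∀ v : V, ∃ d : O_F, d ≠ 0 ∧ d • v ∈ Λ :=
    exists_ne_zero_smul_mem_of_span_eq_top hspan
  have hR : ∀ d : O_F, d ≠ 0 → ∀ a : K, d • a = 0 → a = 0 := by
    intro d hd a ha
    rw [← algebraMap_smul F d a, smul_eq_zero] at ha
    exact ha.resolve_left (by simpa using hd)
  have hO := multiplierOrder.exists_ne_zero_smul_mem (K := K) hfg hden
  obtain ⟨d, hd, hv⟩ := hden (e.symm 1)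
  have hv0 : ∀ a : K, a • d • e.symm 1 = 0 → a = 0 := by
    intro a ha
    refine hR d hd a ?_
    rw [← algebraMap_smul K d, smul_smul, ← map_smul, e.symm.map_eq_zero_iff] at ha
    rw [Algebra.smul_def, mul_comm]
    simpa using ha
  refine ⟨multiplierOrder.fg hfg hv hv0, ?_, ?_, multiplierOrder.rank_eq_one e hR hO hv hv0⟩
  · refine eq_top_iff.mpr fun a _ => ?_
    obtain ⟨c, hc, hca⟩ := hO a
    have hcF : algebraMap O_F F c ≠ 0 := by simpa using hc
    rw [← inv_smul_smul₀ hcF a, algebraMap_smul]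
    exact Submodule.smul_mem _ _ (Submodule.subset_span hca)
  · refine multiplierOrder.projective_of_one_mem_span e ?_
    have h := one_mem_span_mul_of_quadratic hquad
      (hfg.map ((e : V →ₗ[K] K).restrictScalars O_F)) (fun k => by
        obtain ⟨c, hc, hck⟩ := hden (e.symm k)
        refine ⟨c, hc, c • e.symm k, hck, ?_⟩
        change e (c • e.symm k) = c • k
        rw [← algebraMap_smul K c, map_smul, e.apply_symm_apply, algebraMap_smul])
    refine Submodule.span_mono ?_ h
    rintro _ ⟨m, hm, _, ⟨x, hx, rfl⟩, rfl⟩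
    refine ⟨m, fun y hy z hz => ?_, x, hx, rfl⟩
    obtain ⟨w, hw, hwe⟩ := hm _ ⟨y, hy, rfl⟩ _ ⟨z, hz, rfl⟩
    have : (m * e y) • z = w := e.injective (by simpa using hwe.symm)
    exact this ▸ hw
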